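/- Assume (H1) and (H2). Let τ₀ ≥ 0 and ω₀ < τ₀, and suppose x̄₀ ∈ A_{ω₀,0} ∩ Γ_{τ₀}. Then there exists L ∈ ℝ such that g(x;u) → L as x → x̄₀ with x ∈ Q_{λ₀}(x̄₀), and for every 0 < λ < λ₀ one has lim_{ρ→0⁺} ⨍_{Q_{λ,ρ}(x̄₀)} |u(x) − L|ᵖ dx = 0. -/

import Mathlib

open MeasureTheory Metric Set Filter
open scoped ENNReal NNReal Topology

noncomputable section

abbrev Euc (n : ℕ) := EuclideanSpace ℝ (Fin n)

variable {n : ℕ}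

/-- Distance to the boundary of `Ω`. -/
def dB (Ω : Set (Euc n)) (x : Euc n) : ℝ := infDist x (frontier Ω)

/-- `Ψ(x) = B(x, d(x)/2)`. -/
def PsiB (Ω : Set (Euc n)) (x : Euc n) : Set (Euc n) := ball x (dB Ω x / 2)

/-- `Φ(x) = B(x, d(x)/6)`. -/
def PhiB (Ω : Set (Euc n)) (x : Euc n) : Set (Euc n) := ball x (dB Ω x / 6)

/-- The integrand of `ν(·;u)`. -/
def nuInt (Ω : Set (Euc n)) (s : Euc n → ℝ) (p : ℝ) (u : Euc n → ℝ) (x : Euc n) : ℝ :=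
  (⨍ y in PsiB Ω x, |u y - u x|) ^ p * dB Ω x ^ (-(p * s x))

/-- `ν(E;u)`. -/
def nuM (Ω : Set (Euc n)) (s : Euc n → ℝ) (p : ℝ) (u : Euc n → ℝ) (E : Set (Euc n)) : ℝ :=
  ∫ x in Ω ∩ E, nuInt Ω s p u x

/-- Membership in the nonlocal space `𝒩^{s,p}(Ω)`: `u ∈ L¹(Ω)` and `ν(Ω;u) < ∞`. -/
def MemN (Ω : Set (Euc n)) (s : Euc n → ℝ) (p : ℝ) (u : Euc n → ℝ) : Prop :=
  IntegrableOn u Ω volume ∧ IntegrableOn (nuInt Ω s p u) Ω volume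

/-- `g(x;u)`, the mean of `u` over `Φ(x)`. -/
def gFun (Ω : Set (Euc n)) (u : Euc n → ℝ) (x : Euc n) : ℝ := ⨍ y in PhiB Ω x, u y

/-- The approach region `Q^θ_λ(xb)`. -/
def Qreg (Ω : Set (Euc n)) (lam θ : ℝ) (xb : Euc n) : Set (Euc n) :=
  {x | x ∈ Ω ∧ (lam * dist xb x) ^ θ < dB Ω x}

/-- `Q` is an `(η,θ)`-corkscrew region for `xb` with radius `δ₀`. -/
def IsCorkscrew (Ω Q : Set (Euc n)) (xb : Euc n) (η θ δ₀ : ℝ) : Prop :=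
  ∀ δ : ℝ, 0 < δ → δ ≤ δ₀ →
    ∃ x ∈ Q, η * δ < dist xb x ∧ dist xb x < δ ∧ (η * δ) ^ θ < dB Ω x

/-- `E` is `(C,θ)`-connected to `xb`, with radius `ρ₀` and gauge `ε`. -/
def ConnectedTo (Ω E : Set (Euc n)) (xb : Euc n) (C θ ρ₀ : ℝ) (ε : ℝ → ℝ) : Prop :=
  ∀ lam : ℝ, 0 < lam → lam < 1 →
    0 < ε lam ∧ ε lam ≤ lam ∧
      ∀ ρ : ℝ, 0 < ρ → ρ ≤ ρ₀ → ∀ x ∈ E ∩ ball xb ρ, ∀ x' ∈ E ∩ ball xb ρ,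
        (lam * ρ) ^ θ ≤ dB Ω x → (lam * ρ) ^ θ ≤ dB Ω x' →
        ∃ γ : ℝ → Euc n, ContinuousOn γ (Icc 0 1) ∧ γ 0 = x ∧ γ 1 = x' ∧
          (∀ τ ∈ Icc (0:ℝ) 1, γ τ ∈ E ∧ ε lam * ρ ^ θ ≤ dB Ω (γ τ)) ∧
          eVariationOn γ (Icc 0 1) ≤ ENNReal.ofReal (C * ρ)

/-- The piecewise bilinear function `α(s,θ)`. -/
def alphaFun (n : ℕ) (p sv θ : ℝ) : ℝ :=
  if p * sv - n ≤ p - 1 then p * (1 - θ) + (p * sv - n) * θ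
  else (1 - θ) + (p * sv - n)

/-- `s̲_δ(xb)`. -/
def sLow (Ω : Set (Euc n)) (s : Euc n → ℝ) (xb : Euc n) (δ : ℝ) : ℝ :=
  sInf (s '' (Ω ∩ ball xb δ))

/-- `α̲_δ(xb)`. -/
def alphaLow (Ω : Set (Euc n)) (s : Euc n → ℝ) (p : ℝ) (θΓ : Euc n → ℝ)
    (xb : Euc n) (δ : ℝ) : ℝ :=
  alphaFun n p (sLow Ω s xb δ) (θΓ xb)

/-- `α̲_0(xb) = lim_{δ → 0⁺} α̲_δ(xb)`. -/
def alphaLow0 (Ω : Set (Euc n)) (s : Euc n → ℝ) (p : ℝ) (θΓ : Euc n → ℝ) (xb : Euc n) : ℝ :=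
  limUnder (𝓝[>] (0:ℝ)) (fun δ => alphaLow Ω s p θΓ xb δ)

/-- `Γ_τ`: points of `Γ` where `limsup_{ρ→0⁺} ρ^{-τ} ν(B(xb,ρ);u) < ∞`. -/
def GammaTau (Ω : Set (Euc n)) (s : Euc n → ℝ) (p : ℝ) (u : Euc n → ℝ)
    (Γ : Set (Euc n)) (τ : ℝ) : Set (Euc n) :=
  {xb ∈ Γ | ∃ M : ℝ, ∀ᶠ ρ in 𝓝[>] (0:ℝ), ρ ^ (-τ) * nuM Ω s p u (ball xb ρ) ≤ M}

/-- `M_τ(xb) = sup_{0<ρ≤δΓ} ρ^{-τ} ν(B(xb,ρ);u)`. -/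
def Mtau (Ω : Set (Euc n)) (s : Euc n → ℝ) (p : ℝ) (u : Euc n → ℝ)
    (δΓ τ : ℝ) (xb : Euc n) : ℝ :=
  sSup ((fun ρ => ρ ^ (-τ) * nuM Ω s p u (ball xb ρ)) '' Ioc 0 δΓ)


/-! ### Elementary facts about the distance to the boundary -/

lemma dB_le_add (Ω : Set (Euc n)) (x y : Euc n) : dB Ω x ≤ dB Ω y + dist x y :=
  infDist_le_infDist_add_dist

lemma dB_nonneg (Ω : Set (Euc n)) (x : Euc n) : 0 ≤ dB Ω x := infDist_nonneg

lemma dB_le_dist {Ω : Set (Euc n)} {xb : Euc n} (h : xb ∈ frontier Ω) (x : Euc n) :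
    dB Ω x ≤ dist xb x := by
  rw [dist_comm]; exact infDist_le_dist_of_mem h

lemma dB_pos {Ω : Set (Euc n)} (hΩ : IsOpen Ω) (hfr : (frontier Ω).Nonempty) {x : Euc n}
    (hx : x ∈ Ω) : 0 < dB Ω x := by
  refine (isClosed_frontier.notMem_iff_infDist_pos hfr).1 ?_
  intro h
  rw [hΩ.frontier_eq] at h
  exact h.2 hx

lemma ball_dB_subset {Ω : Set (Euc n)} (hΩ : IsOpen Ω) (hfr : (frontier Ω).Nonempty) {x : Euc n}
    (hx : x ∈ Ω) : ball x (dB Ω x) ⊆ Ω := by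
  have hpc : IsPreconnected (ball x (dB Ω x)) := (convex_ball x _).isPreconnected
  have hd : Disjoint (ball x (dB Ω x)) (frontier Ω) := disjoint_ball_infDist
  refine hpc.subset_left_of_subset_union hΩ (isClosed_closure (s := Ω)).isOpen_compl ?_ ?_ ?_
  · exact (disjoint_compl_right.mono_left subset_closure)
  · intro y hy
    by_cases h : y ∈ closure Ω
    · left
      by_contra h'
      have : y ∈ frontier Ω := by rw [hΩ.frontier_eq]; exact ⟨h, h'⟩
      exact Set.disjoint_left.1 hd hy this
    · right; exact h
  · exact ⟨x, mem_ball_self (dB_pos hΩ hfr hx), hx⟩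

/-- The averaged oscillation. -/
def osc (Ω : Set (Euc n)) (u : Euc n → ℝ) (x : Euc n) : ℝ := ⨍ y in PsiB Ω x, |u y - u x|

lemma osc_nonneg (Ω : Set (Euc n)) (u : Euc n → ℝ) (x : Euc n) : 0 ≤ osc Ω u x := by
  unfold osc
  rw [setAverage_eq]
  have : 0 ≤ ∫ y in PsiB Ω x, |u y - u x| := integral_nonneg fun y => abs_nonneg _
  simp only [smul_eq_mul]; positivity

lemma nuInt_nonneg (Ω : Set (Euc n)) (s : Euc n → ℝ) (p : ℝ) (u : Euc n → ℝ) (x : Euc n) :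
    0 ≤ nuInt Ω s p u x :=
  mul_nonneg (Real.rpow_nonneg (osc_nonneg Ω u x) _) (Real.rpow_nonneg (dB_nonneg _ _) _)

lemma vol_ball {n : ℕ} (x : Euc n) {r : ℝ} (hr : 0 < r) :
    volume.real (ball x r) = r ^ n * volume.real (ball (0 : Euc n) 1) := by
  rw [measureReal_def, Measure.addHaar_ball_of_pos _ _ hr, ENNReal.toReal_mul,
    ENNReal.toReal_ofReal (by positivity), measureReal_def]
  simp

lemma vol_unit_pos (n : ℕ) : 0 < volume.real (ball (0 : Euc n) 1) :=
  ENNReal.toReal_pos (measure_ball_pos _ _ one_pos).ne' measure_ball_lt_top.ne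

/-- Pointwise comparison of `u y` with nearby averages. -/
lemma abs_sub_gFun_le {Ω : Set (Euc n)} (hΩ : IsOpen Ω) (hfr : (frontier Ω).Nonempty)
    {u : Euc n → ℝ} (hu : IntegrableOn u Ω) {y x' : Euc n} (hy : y ∈ Ω) (hx' : x' ∈ Ω)
    (h1 : dist y x' + dB Ω x' / 6 ≤ dB Ω y / 2) (h2 : dB Ω y / 2 ≤ 4 * (dB Ω x' / 6)) :
    |u y - gFun Ω u x'| ≤ 4 ^ n * osc Ω u y := by
  have hdy := dB_pos hΩ hfr hy
  have hdx := dB_pos hΩ hfr hx'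
  have hsub : PhiB Ω x' ⊆ PsiB Ω y := by
    apply ball_subset_ball'
    rw [dist_comm]; linarith
  have hPsiΩ : PsiB Ω y ⊆ Ω :=
    (ball_subset_ball (by linarith)).trans (ball_dB_subset hΩ hfr hy)
  have huPsi : IntegrableOn u (PsiB Ω y) := hu.mono_set hPsiΩ
  have hfinPsi : volume (PsiB Ω y) ≠ ∞ := measure_ball_lt_top.ne
  have hfinPhi : volume (PhiB Ω x') ≠ ∞ := measure_ball_lt_top.ne
  have hintPsi : IntegrableOn (fun z => u z - u y) (PsiB Ω y) :=
    huPsi.sub (integrableOn_const hfinPsi)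
  have hintPhi := hintPsi.mono_set hsub
  have huPhi := huPsi.mono_set hsub
  have hvPhi : volume.real (PhiB Ω x') = (dB Ω x' / 6) ^ n * volume.real (ball (0 : Euc n) 1) :=
    vol_ball _ (by linarith)
  have hvPsi : volume.real (PsiB Ω y) = (dB Ω y / 2) ^ n * volume.real (ball (0 : Euc n) 1) :=
    vol_ball _ (by linarith)
  have hω := vol_unit_pos n
  have hvPhi0 : 0 < volume.real (PhiB Ω x') := by rw [hvPhi]; positivity
  have hvPsi0 : 0 < volume.real (PsiB Ω y) := by rw [hvPsi]; positivity
  have hcmp : volume.real (PsiB Ω y) ≤ 4 ^ n * volume.real (PhiB Ω x') := by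
    rw [hvPsi, hvPhi, ← mul_assoc, ← mul_pow]
    gcongr
  have e1 : gFun Ω u x' - u y = (volume.real (PhiB Ω x'))⁻¹ * ∫ z in PhiB Ω x', (u z - u y) := by
    unfold gFun
    rw [setAverage_eq, integral_sub huPhi (integrableOn_const hfinPhi), setIntegral_const]
    simp only [smul_eq_mul]
    field_simp
  have e2 : |∫ z in PhiB Ω x', (u z - u y)| ≤ ∫ z in PsiB Ω y, |u z - u y| := by
    refine (abs_integral_le_integral_abs).trans ?_
    exact setIntegral_mono_set hintPsi.abs (ae_of_all _ fun z => abs_nonneg _)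
      hsub.eventuallyLE
  rw [abs_sub_comm, e1, abs_mul, abs_of_pos (inv_pos.2 hvPhi0)]
  have e3 : osc Ω u y = (volume.real (PsiB Ω y))⁻¹ * ∫ z in PsiB Ω y, |u z - u y| := by
    unfold osc; rw [setAverage_eq]; rfl
  have hI : 0 ≤ ∫ z in PsiB Ω y, |u z - u y| := integral_nonneg fun z => abs_nonneg _
  have hinv : (volume.real (PhiB Ω x'))⁻¹ ≤ 4 ^ n * (volume.real (PsiB Ω y))⁻¹ := by
    rw [inv_le_iff_one_le_mul₀ hvPhi0]
    have : 4 ^ n * (volume.real (PsiB Ω y))⁻¹ * volume.real (PhiB Ω x')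
      = (4 ^ n * volume.real (PhiB Ω x')) / volume.real (PsiB Ω y) := by field_simp
    rw [this, one_le_div hvPsi0]; exact hcmp
  rw [e3, ← mul_assoc]
  exact mul_le_mul hinv e2 (abs_nonneg _) (by positivity)

lemma abs_sub_gFun_self_le {Ω : Set (Euc n)} (hΩ : IsOpen Ω) (hfr : (frontier Ω).Nonempty)
    {u : Euc n → ℝ} (hu : IntegrableOn u Ω) {y : Euc n} (hy : y ∈ Ω) :
    |u y - gFun Ω u y| ≤ 4 ^ n * osc Ω u y := by
  have := dB_nonneg Ω y
  refine abs_sub_gFun_le hΩ hfr hu hy hy ?_ ?_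
  · rw [dist_self]; linarith
  · linarith

lemma gFun_step {Ω : Set (Euc n)} (hΩ : IsOpen Ω) (hfr : (frontier Ω).Nonempty)
    {u : Euc n → ℝ} (hu : IntegrableOn u Ω) {x x' : Euc n} (hx : x ∈ Ω)
    (hxx' : dist x x' ≤ dB Ω x / 14) {y : Euc n} (hy : y ∈ PhiB Ω x) :
    |gFun Ω u x - gFun Ω u x'| ≤ 2 * 4 ^ n * osc Ω u y := by
  have hd := dB_pos hΩ hfr hx
  have hyx : dist y x < dB Ω x / 6 := hy
  have hyΩ : y ∈ Ω := ball_dB_subset hΩ hfr hx (mem_ball.2 (by linarith))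
  have hxΩ' : x' ∈ Ω := ball_dB_subset hΩ hfr hx (mem_ball.2 (by rw [dist_comm]; linarith))
  have a1 := dB_le_add Ω x y
  have a2 := dB_le_add Ω y x
  have a3 := dB_le_add Ω x x'
  have a4 := dB_le_add Ω x' x
  have a5 := dist_triangle y x x'
  rw [dist_comm x y] at a1
  rw [dist_comm x' x] at a4
  have b1 := abs_sub_gFun_le hΩ hfr hu hyΩ hx (by linarith) (by linarith)
  have b2 := abs_sub_gFun_le hΩ hfr hu hyΩ hxΩ' (by linarith) (by linarith)
  have := abs_sub_le (gFun Ω u x) (u y) (gFun Ω u x')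
  rw [abs_sub_comm (gFun Ω u x) (u y)] at this
  linarith

/-- Chaining along a rectifiable path with steps comparable to `d`. -/
lemma chain_bound {E : Type*} [PseudoMetricSpace E] (γ : ℝ → E) (hγ : ContinuousOn γ (Icc 0 1))
    (d f : E → ℝ) (κ m D K : ℝ) (hκ : 0 < κ) (hm : 0 < m) (hK : 0 ≤ K)
    (hd : ∀ t ∈ Icc (0:ℝ) 1, m ≤ d (γ t)) (hD : ∀ t ∈ Icc (0:ℝ) 1, d (γ t) ≤ D)
    (hf : ∀ t ∈ Icc (0:ℝ) 1, ∀ z, dist (γ t) z ≤ κ * d (γ t) → |f (γ t) - f z| ≤ K * d (γ t)) :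
    ∀ N : ℕ, ∀ a ∈ Icc (0:ℝ) 1, ∀ ℓ : ℝ, 0 ≤ ℓ → eVariationOn γ (Icc a 1) ≤ ENNReal.ofReal ℓ →
      ℓ < N * (κ * m) → |f (γ a) - f (γ 1)| ≤ K * (ℓ / κ + D) := by
  intro N
  induction N with
  | zero =>
    intro a ha ℓ hℓ _ hN
    simp at hN; linarith
  | succ N ih =>
    intro a ha ℓ hℓ hV hN
    have hda := hd a ha
    have hDa := hD a ha
    have h1 : (1:ℝ) ∈ Icc (0:ℝ) 1 := ⟨zero_le_one, le_rfl⟩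
    by_cases hc : dist (γ a) (γ 1) ≤ κ * d (γ a)
    · refine (hf a ha _ hc).trans ?_
      have : 0 ≤ ℓ / κ := by positivity
      exact mul_le_mul_of_nonneg_left (by linarith) hK
    · push Not at hc
      have hcont : ContinuousOn (fun t => dist (γ a) (γ t)) (Icc a 1) :=
        fun y hy => tendsto_const_nhds.dist (hγ.mono (Icc_subset_Icc_left ha.1) y hy)
      have hmem : κ * d (γ a) ∈ Icc (dist (γ a) (γ a)) (dist (γ a) (γ 1)) := by
        refine ⟨?_, hc.le⟩
        rw [dist_self]; nlinarith
      obtain ⟨t, ht, hte⟩ := intermediate_value_Icc ha.2 hcont hmem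
      simp only at hte
      have ht' : t ∈ Icc (0:ℝ) 1 := ⟨ha.1.trans ht.1, ht.2⟩
      have hadd := eVariationOn.Icc_add_Icc γ (s := univ) ht.1 ht.2 (mem_univ t)
      simp only [univ_inter] at hadd
      have hed : ENNReal.ofReal (κ * d (γ a)) ≤ eVariationOn γ (Icc a t) := by
        rw [← hte, ← edist_dist]
        exact eVariationOn.edist_le γ ⟨le_rfl, ht.1⟩ ⟨ht.1, le_rfl⟩
      have hκd : 0 ≤ κ * d (γ a) := by nlinarith
      have hsum : ENNReal.ofReal (κ * d (γ a)) + eVariationOn γ (Icc t 1) ≤ ENNReal.ofReal ℓ :=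
        (add_le_add_left hed _).trans (hadd.le.trans hV)
      have hle : κ * d (γ a) ≤ ℓ := by
        have := (le_self_add).trans hsum
        exact (ENNReal.ofReal_le_ofReal_iff hℓ).1 this
      have hV' : eVariationOn γ (Icc t 1) ≤ ENNReal.ofReal (ℓ - κ * d (γ a)) := by
        rw [ENNReal.ofReal_sub _ hκd]
        exact ENNReal.le_sub_of_add_le_left ENNReal.ofReal_ne_top hsum
      have hκm : κ * m ≤ κ * d (γ a) := by gcongr
      have := ih t ht' (ℓ - κ * d (γ a)) (by linarith) hV' (by push_cast at hN; linarith)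
      have h3 := hf a ha (γ t) hte.le
      have h4 := abs_sub_le (f (γ a)) (f (γ t)) (f (γ 1))
      have h5 : K * ((ℓ - κ * d (γ a)) / κ + D) = K * (ℓ / κ + D) - K * d (γ a) := by
        field_simp; ring
      linarith

/-- Pointwise control of the oscillation by the density of `ν`. -/
lemma osc_rpow_le {Ω : Set (Euc n)} (hΩ : IsOpen Ω) {xb : Euc n} (hxb : xb ∈ frontier Ω)
    {s : Euc n → ℝ} {p sl δ0 : ℝ} (hp : 1 ≤ p) (hδ0 : δ0 ≤ 1)
    (hsl : ∀ x ∈ Ω ∩ ball xb δ0, sl ≤ s x) (u : Euc n → ℝ) {y : Euc n} (hy : y ∈ Ω ∩ ball xb δ0) :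
    osc Ω u y ^ p ≤ nuInt Ω s p u y * dB Ω y ^ (p * sl) := by
  have hd := dB_pos hΩ ⟨xb, hxb⟩ hy.1
  have hd1 : dB Ω y ≤ 1 := by
    have := dB_le_dist hxb y
    have h2 : dist y xb < δ0 := hy.2
    rw [dist_comm] at this; linarith
  have e : nuInt Ω s p u y = osc Ω u y ^ p * dB Ω y ^ (-(p * s y)) := rfl
  rw [e, mul_assoc, ← Real.rpow_add hd]
  have h1 : 1 ≤ dB Ω y ^ (-(p * s y) + p * sl) := by
    apply Real.one_le_rpow_of_pos_of_le_one_of_nonpos hd hd1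
    have := hsl y hy
    nlinarith
  have h0 : 0 ≤ osc Ω u y ^ p := Real.rpow_nonneg (osc_nonneg _ _ _) _
  nlinarith

/-- Local oscillation estimate for `g`. -/
lemma gFun_local {Ω : Set (Euc n)} (hΩ : IsOpen Ω) {xb : Euc n} (hxb : xb ∈ frontier Ω)
    {s : Euc n → ℝ} {p sl δ0 τ M : ℝ} (hp : 1 ≤ p) (hδ0 : δ0 ≤ 1) (hsl0 : 0 ≤ sl) (hM0 : 0 ≤ M)
    (hsl : ∀ x ∈ Ω ∩ ball xb δ0, sl ≤ s x) {u : Euc n → ℝ} (hu : MemN Ω s p u)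
    (hM : ∀ R, 0 < R → R < δ0 → nuM Ω s p u (ball xb R) ≤ M * R ^ τ) :
    ∃ C1 : ℝ, 0 ≤ C1 ∧ ∀ R, 0 < R → R < δ0 → ∀ x ∈ Ω, PhiB Ω x ⊆ ball xb R →
      ∀ x', dist x x' ≤ dB Ω x / 14 →
        |gFun Ω u x - gFun Ω u x'| ≤ C1 * dB Ω x ^ ((p * sl - n) / p) * R ^ (τ / p) := by
  have hfr : (frontier Ω).Nonempty := ⟨xb, hxb⟩
  have hω := vol_unit_pos n
  set ω := volume.real (ball (0 : Euc n) 1) with hωdef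
  set B : ℝ := (2 * 4 ^ n) ^ p * 2 ^ (p * sl) * M * 6 ^ n / ω with hB
  have hB0 : 0 ≤ B := by positivity
  refine ⟨B ^ (1 / p), by positivity, ?_⟩
  intro R hR hRδ x hx hsub x' hxx'
  have hp0 : 0 < p := by linarith
  have hd := dB_pos hΩ hfr hx
  set D := |gFun Ω u x - gFun Ω u x'| with hD
  have hD0 : 0 ≤ D := abs_nonneg _
  have hPhiΩ : PhiB Ω x ⊆ Ω :=
    (ball_subset_ball (by linarith)).trans (ball_dB_subset hΩ hfr hx)
  set K := (2 * 4 ^ n) ^ p * (2 * dB Ω x) ^ (p * sl) with hK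
  have hK0 : 0 ≤ K := by positivity
  have hpt : ∀ y ∈ PhiB Ω x, D ^ p ≤ K * nuInt Ω s p u y := by
    intro y hy
    have hyx : dist y x < dB Ω x / 6 := hy
    have h1 := gFun_step hΩ hfr hu.1 hx hxx' hy
    have h2 : D ^ p ≤ (2 * 4 ^ n) ^ p * osc Ω u y ^ p := by
      rw [← Real.mul_rpow (by positivity) (osc_nonneg _ _ _)]
      exact Real.rpow_le_rpow hD0 h1 hp0.le
    have hyB : y ∈ Ω ∩ ball xb δ0 := ⟨hPhiΩ hy, ball_subset_ball hRδ.le (hsub hy)⟩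
    have h3 := osc_rpow_le hΩ hxb hp hδ0 hsl u hyB
    have h4 : dB Ω y ^ (p * sl) ≤ (2 * dB Ω x) ^ (p * sl) := by
      apply Real.rpow_le_rpow (dB_nonneg _ _) _ (by positivity)
      have := dB_le_add Ω y x
      linarith
    have hn0 := nuInt_nonneg Ω s p u y
    calc D ^ p ≤ (2 * 4 ^ n) ^ p * osc Ω u y ^ p := h2
      _ ≤ (2 * 4 ^ n) ^ p * (nuInt Ω s p u y * (2 * dB Ω x) ^ (p * sl)) := by
          gcongr
          exact h3.trans (by gcongr)
      _ = K * nuInt Ω s p u y := by rw [hK]; ring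
  have hvPhi : volume.real (PhiB Ω x) = (dB Ω x / 6) ^ n * ω := vol_ball _ (by linarith)
  have hfin : volume (PhiB Ω x) ≠ ∞ := measure_ball_lt_top.ne
  have hint : D ^ p * volume.real (PhiB Ω x) ≤ K * (M * R ^ τ) := by
    have e1 : ∫ _y in PhiB Ω x, D ^ p = volume.real (PhiB Ω x) * D ^ p := by
      rw [setIntegral_const]; rfl
    have e2 : ∫ _y in PhiB Ω x, D ^ p ≤ ∫ y in PhiB Ω x, K * nuInt Ω s p u y :=
      setIntegral_mono_on (integrableOn_const hfin) ((hu.2.mono_set hPhiΩ).const_mul K)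
        measurableSet_ball hpt
    rw [integral_const_mul] at e2
    have e3 : ∫ y in PhiB Ω x, nuInt Ω s p u y ≤ nuM Ω s p u (ball xb R) := by
      refine setIntegral_mono_set (hu.2.mono_set inter_subset_left)
        (ae_of_all _ fun z => nuInt_nonneg _ _ _ _ _) ?_
      exact (show PhiB Ω x ⊆ Ω ∩ ball xb R from subset_inter hPhiΩ hsub).eventuallyLE
    have e4 := mul_le_mul_of_nonneg_left (e3.trans (hM R hR hRδ)) hK0
    linarith
  have hdn : (0:ℝ) < dB Ω x ^ (n:ℝ) := Real.rpow_pos_of_pos hd _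
  have hDp : D ^ p ≤ B * dB Ω x ^ (p * sl - n) * R ^ τ := by
    have hv0 : 0 < volume.real (PhiB Ω x) := by rw [hvPhi]; positivity
    have h1 : D ^ p ≤ K * (M * R ^ τ) / volume.real (PhiB Ω x) := by rwa [le_div_iff₀ hv0]
    refine h1.trans (le_of_eq ?_)
    rw [hvPhi, hK, hB, Real.rpow_sub hd, Real.mul_rpow (by norm_num) hd.le, Real.rpow_natCast,
      div_pow]
    field_simp
  have hfinal : D ≤ (B * dB Ω x ^ (p * sl - n) * R ^ τ) ^ (1 / p) := by
    have := Real.rpow_le_rpow (by positivity) hDp (by positivity : 0 ≤ 1 / p)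
    rwa [← Real.rpow_mul hD0, mul_one_div_cancel hp0.ne', Real.rpow_one] at this
  refine hfinal.trans (le_of_eq ?_)
  rw [Real.mul_rpow (by positivity) (by positivity), Real.mul_rpow (by positivity) (by positivity),
    ← Real.rpow_mul hd.le, ← Real.rpow_mul hR.le]
  simp only [mul_one_div]

lemma rpow_le_add_of_mem {m1 m2 d q : ℝ} (h1 : 0 < m1) (h2 : m1 ≤ d) (h3 : d ≤ m2) :
    d ^ q ≤ m1 ^ q + m2 ^ q := by
  have hd : 0 < d := h1.trans_le h2
  have hm2 : 0 < m2 := hd.trans_le h3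
  have a1 : 0 < m1 ^ q := Real.rpow_pos_of_pos h1 _
  have a2 : 0 < m2 ^ q := Real.rpow_pos_of_pos hm2 _
  rcases le_total 0 q with hq | hq
  · have := Real.rpow_le_rpow hd.le h3 hq
    linarith
  · have := Real.rpow_le_rpow_of_nonpos h1 h2 hq
    linarith

/-- Uniform comparison of `g` at points of a connected approach region. -/
lemma gFun_conn {Ω : Set (Euc n)} (hΩ : IsOpen Ω) {xb : Euc n} (hxb : xb ∈ frontier Ω)
    {s : Euc n → ℝ} {p sl δ0 τ M θ CΓ δΓ σ : ℝ} {ε : ℝ → ℝ} (hp : 1 ≤ p) (hδ00 : 0 < δ0)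
    (hδ0 : δ0 ≤ 1)
    (hsl0 : 0 ≤ sl) (hM0 : 0 ≤ M) (hδΓ : 0 < δΓ)
    (hsl : ∀ x ∈ Ω ∩ ball xb δ0, sl ≤ s x) {u : Euc n → ℝ} (hu : MemN Ω s p u)
    (hM : ∀ R, 0 < R → R < δ0 → nuM Ω s p u (ball xb R) ≤ M * R ^ τ)
    (hCΓ : 1 ≤ CΓ)
    (H2 : ConnectedTo Ω (Ω ∩ ball xb δΓ) xb CΓ θ (δΓ / (3 * CΓ)) ε)
    (hσ1 : σ ≤ 1 + θ * ((p * sl - n) / p - 1) + τ / p)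
    (hσ2 : σ ≤ 1 + ((p * sl - n) / p - 1) + τ / p)
    {lam : ℝ} (hlam : 0 < lam) (hlam1 : lam < 1) :
    ∃ C : ℝ, 0 ≤ C ∧ ∃ ρ1 : ℝ, 0 < ρ1 ∧ ρ1 ≤ 1 ∧ ρ1 ≤ δΓ ∧ ∀ ρ, 0 < ρ → ρ ≤ ρ1 →
      ∀ x ∈ Ω ∩ ball xb ρ, ∀ x' ∈ Ω ∩ ball xb ρ, (lam * ρ) ^ θ ≤ dB Ω x →
        (lam * ρ) ^ θ ≤ dB Ω x' → |gFun Ω u x - gFun Ω u x'| ≤ C * ρ ^ σ := by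
  obtain ⟨C1, hC1, hloc⟩ := gFun_local hΩ hxb hp hδ0 hsl0 hM0 hsl hu hM
  obtain ⟨hε0, hεlam, hpath⟩ := H2 lam hlam hlam1
  set q := (p * sl - n) / p - 1 with hq
  set e := ε lam
  have hE : 0 < CΓ + 1 := by linarith
  set ρ1 : ℝ := min (min (δΓ / (3 * CΓ)) (δ0 / (4 * (CΓ + 1)))) 1 with hρ1
  set C : ℝ := C1 * (e ^ q + (CΓ + 1) ^ q) * (2 * (CΓ + 1)) ^ (τ / p) * (15 * CΓ + 1) with hC
  have hC0 : 0 ≤ C := by positivity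
  refine ⟨C, hC0, ρ1, by positivity, min_le_right _ _, ?_, ?_⟩
  · refine (min_le_left _ _).trans ((min_le_left _ _).trans ?_)
    apply div_le_self hδΓ.le; linarith
  intro ρ hρ hρ1' x hx x' hx' hdx hdx'
  have hρa : ρ ≤ δΓ / (3 * CΓ) := hρ1'.trans ((min_le_left _ _).trans (min_le_left _ _))
  have hρb : ρ ≤ δ0 / (4 * (CΓ + 1)) := hρ1'.trans ((min_le_left _ _).trans (min_le_right _ _))
  have hρc : ρ ≤ 1 := hρ1'.trans (min_le_right _ _)
  have hρδ : ρ ≤ δΓ := hρa.trans (div_le_self hδΓ.le (by linarith))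
  obtain ⟨γ, hγc, hγ0, hγ1, hγ, hlen⟩ := hpath ρ hρ hρa x ⟨⟨hx.1, ball_subset_ball hρδ hx.2⟩, hx.2⟩
    x' ⟨⟨hx'.1, ball_subset_ball hρδ hx'.2⟩, hx'.2⟩ hdx hdx'
  set R := 2 * (CΓ + 1) * ρ with hR
  have hR0 : 0 < R := by positivity
  have hRδ : R < δ0 := by
    rw [le_div_iff₀ (by positivity)] at hρb
    rw [hR]; nlinarith
  have hρθ : 0 < ρ ^ θ := Real.rpow_pos_of_pos hρ _
  have hdist : ∀ t ∈ Icc (0:ℝ) 1, dist xb (γ t) ≤ (CΓ + 1) * ρ := by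
    intro t ht
    have h1 : edist (γ 0) (γ t) ≤ ENNReal.ofReal (CΓ * ρ) :=
      (eVariationOn.edist_le γ (left_mem_Icc.2 zero_le_one) ht).trans hlen
    rw [edist_dist, ENNReal.ofReal_le_ofReal_iff (by positivity), hγ0] at h1
    have h2 : dist x xb < ρ := hx.2
    have h3 := dist_triangle xb x (γ t)
    rw [dist_comm xb x] at h3
    linarith
  have hDt : ∀ t ∈ Icc (0:ℝ) 1, dB Ω (γ t) ≤ (CΓ + 1) * ρ := fun t ht =>
    (dB_le_dist hxb _).trans (hdist t ht)
  set K := C1 * ((e * ρ ^ θ) ^ q + ((CΓ + 1) * ρ) ^ q) * R ^ (τ / p) with hK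
  have hK0 : 0 ≤ K := by positivity
  have hstep : ∀ t ∈ Icc (0:ℝ) 1, ∀ z, dist (γ t) z ≤ 1 / 14 * dB Ω (γ t) →
      |gFun Ω u (γ t) - gFun Ω u z| ≤ K * dB Ω (γ t) := by
    intro t ht z hz
    have hΩt : γ t ∈ Ω := (hγ t ht).1.1
    have hdpos := dB_pos hΩ ⟨xb, hxb⟩ hΩt
    have hsub : PhiB Ω (γ t) ⊆ ball xb R := by
      apply ball_subset_ball'
      have h1 := hDt t ht
      have h2 := hdist t ht
      rw [dist_comm, hR]
      nlinarith
    have h1 := hloc R hR0 hRδ (γ t) hΩt hsub z (by linarith)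
    have h2 : dB Ω (γ t) ^ ((p * sl - n) / p) = dB Ω (γ t) ^ q * dB Ω (γ t) := by
      rw [hq, Real.rpow_sub_one hdpos.ne']; field_simp
    have h3 := rpow_le_add_of_mem (q := q) (by positivity) (hγ t ht).2 (hDt t ht)
    rw [h2] at h1
    refine h1.trans ?_
    calc C1 * (dB Ω (γ t) ^ q * dB Ω (γ t)) * R ^ (τ / p)
        ≤ C1 * (((e * ρ ^ θ) ^ q + ((CΓ + 1) * ρ) ^ q) * dB Ω (γ t)) * R ^ (τ / p) := by
          gcongr
      _ = K * dB Ω (γ t) := by rw [hK]; ring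
  obtain ⟨N, hN⟩ := exists_nat_gt (CΓ * ρ / (1 / 14 * (e * ρ ^ θ)))
  have hN' : CΓ * ρ < N * (1 / 14 * (e * ρ ^ θ)) := by
    rwa [div_lt_iff₀ (by positivity)] at hN
  have hch := chain_bound γ hγc (dB Ω) (gFun Ω u) (1 / 14) (e * ρ ^ θ) ((CΓ + 1) * ρ) K
    (by norm_num) (by positivity) hK0 (fun t ht => (hγ t ht).2) hDt hstep N 0
    ⟨le_rfl, zero_le_one⟩ (CΓ * ρ) (by positivity) hlen hN'
  rw [hγ0, hγ1] at hch
  refine hch.trans ?_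
  have hR' : R ^ (τ / p) = (2 * (CΓ + 1)) ^ (τ / p) * ρ ^ (τ / p) := by
    rw [hR, Real.mul_rpow (by positivity) hρ.le]
  have i1 : ρ ^ (θ * q) * ρ ^ (τ / p) * ρ ≤ ρ ^ σ := by
    rw [← Real.rpow_add hρ, ← Real.rpow_add_one hρ.ne']
    exact Real.rpow_le_rpow_of_exponent_ge hρ hρc (by linarith)
  have i2 : ρ ^ q * ρ ^ (τ / p) * ρ ≤ ρ ^ σ := by
    rw [← Real.rpow_add hρ, ← Real.rpow_add_one hρ.ne']
    exact Real.rpow_le_rpow_of_exponent_ge hρ hρc (by linarith)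
  rw [hK, hR', Real.mul_rpow hε0.le hρθ.le, Real.mul_rpow hE.le hρ.le, ← Real.rpow_mul hρ.le]
  set T := (2 * (CΓ + 1)) ^ (τ / p)
  have hT : 0 ≤ T := by positivity
  have he : 0 ≤ e ^ q := by positivity
  have hEq : 0 ≤ (CΓ + 1) ^ q := by positivity
  calc C1 * (e ^ q * ρ ^ (θ * q) + (CΓ + 1) ^ q * ρ ^ q) * (T * ρ ^ (τ / p)) *
        (CΓ * ρ / (1 / 14) + (CΓ + 1) * ρ)
      = C1 * T * (15 * CΓ + 1) * (e ^ q * (ρ ^ (θ * q) * ρ ^ (τ / p) * ρ) +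
          (CΓ + 1) ^ q * (ρ ^ q * ρ ^ (τ / p) * ρ)) := by ring
    _ ≤ C1 * T * (15 * CΓ + 1) * (e ^ q * ρ ^ σ + (CΓ + 1) ^ q * ρ ^ σ) := by gcongr
    _ = C * ρ ^ σ := by rw [hC]; ring

/-- Existence of the boundary limit, with a rate on each approach region. -/
lemma gFun_limit {Ω : Set (Euc n)} (hΩ : IsOpen Ω) {xb : Euc n} (hxb : xb ∈ frontier Ω)
    {g : Euc n → ℝ} {θ lam₀ η₀ δΓ σ : ℝ} (hθ : 1 ≤ θ) (hσ : 0 < σ)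
    (hη₀ : 0 < η₀) (hη₀1 : η₀ < 1)
    (H1 : IsCorkscrew Ω (Qreg Ω lam₀ θ xb) xb η₀ θ δΓ)
    (hconn : ∀ lam : ℝ, 0 < lam → lam < 1 →
      ∃ C : ℝ, 0 ≤ C ∧ ∃ ρ1 : ℝ, 0 < ρ1 ∧ ρ1 ≤ 1 ∧ ρ1 ≤ δΓ ∧ ∀ ρ, 0 < ρ → ρ ≤ ρ1 →
      ∀ x ∈ Ω ∩ ball xb ρ, ∀ x' ∈ Ω ∩ ball xb ρ, (lam * ρ) ^ θ ≤ dB Ω x →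
        (lam * ρ) ^ θ ≤ dB Ω x' → |g x - g x'| ≤ C * ρ ^ σ) :
    ∃ L : ℝ, ∀ lam : ℝ, 0 < lam → lam < 1 → ∃ C : ℝ, 0 ≤ C ∧ ∃ r1 : ℝ, 0 < r1 ∧
      ∀ x ∈ Qreg Ω lam θ xb, dist xb x < r1 → |g x - L| ≤ C * dist xb x ^ σ := by
  have hθ0 : 0 ≤ θ := by linarith
  obtain ⟨C, hC, ρ1, hρ1, hρ11, hρ1δ, hcomp⟩ := hconn (η₀ / 2) (by linarith) (by linarith)
  set δ : ℕ → ℝ := fun k => ρ1 * (1 / 2) ^ k with hδ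
  have hδpos : ∀ k, 0 < δ k := fun k => by simp only [hδ]; positivity
  have hδle : ∀ k, δ k ≤ ρ1 := fun k =>
    mul_le_of_le_one_right hρ1.le (pow_le_one₀ (by norm_num) (by norm_num))
  have hδs : ∀ k, δ (k + 1) = δ k / 2 := fun k => by simp only [hδ, pow_succ]; ring
  have hck := fun k => H1 (δ k) (hδpos k) ((hδle k).trans hρ1δ)
  choose X hXQ hX1 hX2 hX3 using hck
  have hXΩ : ∀ k, X k ∈ Ω := fun k => (hXQ k).1
  have hXb : ∀ k, X k ∈ ball xb (δ k) := fun k => by rw [mem_ball, dist_comm]; exact hX2 k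
  set r : ℝ := (1 / 2) ^ σ with hr
  have hr0 : 0 < r := by positivity
  have hr1 : r < 1 := Real.rpow_lt_one (by norm_num) (by norm_num) hσ
  have hδσ : ∀ k, δ k ^ σ = ρ1 ^ σ * r ^ k := by
    intro k
    simp only [hδ, hr]
    rw [Real.mul_rpow hρ1.le (by positivity), ← Real.rpow_natCast, ← Real.rpow_natCast,
      ← Real.rpow_mul (by norm_num), ← Real.rpow_mul (by norm_num), mul_comm (k:ℝ) σ]
  have hdist : ∀ k, dist (g (X k)) (g (X (k + 1))) ≤ (C * ρ1 ^ σ) * r ^ k := by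
    intro k
    rw [Real.dist_eq, mul_assoc, ← hδσ]
    have hs := hδs k
    have hk := hδpos k
    refine hcomp (δ k) hk (hδle k) _ ⟨hXΩ k, hXb k⟩ _
      ⟨hXΩ _, ball_subset_ball (by linarith) (hXb (k + 1))⟩ ?_ ?_
    · refine le_trans (Real.rpow_le_rpow (by positivity) ?_ hθ0) (hX3 k).le
      nlinarith
    · refine le_trans (Real.rpow_le_rpow (by positivity) ?_ hθ0) (hX3 (k + 1)).le
      rw [hs]; nlinarith
  obtain ⟨L, hL⟩ := cauchySeq_tendsto_of_complete (cauchySeq_of_le_geometric r _ hr1 hdist)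
  have hLk : ∀ k, |g (X k) - L| ≤ C / (1 - r) * δ k ^ σ := by
    intro k
    have := dist_le_of_le_geometric_of_tendsto r _ hr1 hdist hL k
    rw [Real.dist_eq] at this
    refine this.trans (le_of_eq ?_)
    rw [hδσ]; ring
  refine ⟨L, fun lam hlam hlam1 => ?_⟩
  set μ := min (lam / 2) (η₀ / 2) with hμ
  have hμ0 : 0 < μ := by positivity
  have hμa : μ ≤ lam / 2 := min_le_left _ _
  have hμb : μ ≤ η₀ / 2 := min_le_right _ _
  obtain ⟨C', hC', ρ2, hρ2, hρ21, hρ2δ, hcomp'⟩ := hconn μ hμ0 (by linarith)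
  have h1r : 0 < 1 - r := by linarith
  refine ⟨(C' + C / (1 - r)) * 2 ^ σ, by positivity, min (ρ2 / 2) ρ1, by positivity, ?_⟩
  intro x hx hxr
  have hxb' : xb ∉ Ω := by
    intro h; rw [hΩ.frontier_eq] at hxb; exact hxb.2 h
  have hne : xb ≠ x := fun h => hxb' (h ▸ hx.1)
  have hR0 : 0 < dist xb x := dist_pos.2 hne
  have hxr1 : dist xb x < ρ2 / 2 := hxr.trans_le (min_le_left _ _)
  have hxr2 : dist xb x < ρ1 := hxr.trans_le (min_le_right _ _)
  obtain ⟨k, hk1, hk2⟩ := exists_nat_pow_near_of_lt_one (x := dist xb x / ρ1) (y := (1/2 : ℝ))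
    (by positivity) ((div_le_one hρ1).2 hxr2.le) (by norm_num) (by norm_num)
  have hk1' : δ k / 2 < dist xb x := by
    rw [lt_div_iff₀ hρ1] at hk1
    rw [← hδs]; simp only [hδ]; linarith
  have hk2' : dist xb x ≤ δ k := by
    rw [div_le_iff₀ hρ1] at hk2
    simp only [hδ]; linarith
  -- enlarge the radius slightly to get strict membership
  have hkpos := hδpos k
  set ρ := 2 * dist xb x with hρ
  have hδρ : δ k < ρ := by linarith
  have hxball : x ∈ ball xb ρ := by rw [mem_ball, dist_comm]; linarith
  have hXball : X k ∈ ball xb ρ := ball_subset_ball hδρ.le (hXb k)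
  have c1 : (μ * ρ) ^ θ ≤ dB Ω x := by
    refine le_trans (Real.rpow_le_rpow (by positivity) ?_ hθ0) hx.2.le
    rw [hρ]; nlinarith
  have c2 : (μ * ρ) ^ θ ≤ dB Ω (X k) := by
    refine le_trans (Real.rpow_le_rpow (by positivity) ?_ hθ0) (hX3 k).le
    rw [hρ]; nlinarith
  have b1 := hcomp' ρ (by positivity) (by linarith) x ⟨hx.1, hxball⟩ (X k) ⟨hXΩ k, hXball⟩ c1 c2
  have b2 := hLk k
  have b3 : δ k ^ σ ≤ ρ ^ σ := Real.rpow_le_rpow hkpos.le hδρ.le hσ.le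
  have b4 : C / (1 - r) * δ k ^ σ ≤ C / (1 - r) * ρ ^ σ := by gcongr
  have b5 := abs_sub_le (g x) (g (X k)) L
  have b6 : ρ ^ σ = 2 ^ σ * dist xb x ^ σ := by
    rw [hρ, Real.mul_rpow (by norm_num) hR0.le]
  calc |g x - L| ≤ (C' + C / (1 - r)) * ρ ^ σ := by linarith
    _ = _ := by rw [b6]; ring

lemma real_rpow_add_le {a b p : ℝ} (ha : 0 ≤ a) (hb : 0 ≤ b) (hp : 1 ≤ p) :
    (a + b) ^ p ≤ 2 ^ (p - 1) * (a ^ p + b ^ p) := by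
  have := NNReal.rpow_add_le_mul_rpow_add_rpow ⟨a, ha⟩ ⟨b, hb⟩ hp
  exact_mod_cast this

/-- Lower bound for the volume of the truncated approach region. -/
lemma vol_Qreg {n : ℕ} {Ω : Set (Euc n)} (hΩ : IsOpen Ω) {xb : Euc n} (hxb : xb ∈ frontier Ω)
    {θ lam lam₀ η₀ δΓ : ℝ} (hθ : 1 ≤ θ) (hη₀ : 0 < η₀)
    (hlam : 0 < lam) (hlam₀ : lam < lam₀)
    (H1 : IsCorkscrew Ω (Qreg Ω lam₀ θ xb) xb η₀ θ δΓ) :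
    ∃ c : ℝ, 0 < c ∧ ∀ ρ, 0 < ρ → ρ ≤ δΓ →
      c * (ρ ^ θ) ^ n ≤ volume.real (Qreg Ω lam θ xb ∩ ball xb ρ) ∧
      ∀ x ∈ Qreg Ω lam θ xb ∩ ball xb ρ,
        c * dB Ω x ^ n ≤ volume.real (Qreg Ω lam θ xb ∩ ball xb ρ) := by
  have hθ0 : 0 ≤ θ := by linarith
  have hfr : (frontier Ω).Nonempty := ⟨xb, hxb⟩
  have hω := vol_unit_pos n
  set ω := volume.real (ball (0 : Euc n) 1) with hωdef
  have hl0 : 0 < lam₀ := hlam.trans hlam₀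
  set κ := (lam₀ - lam) / (2 * lam₀) with hκ
  have hκ0 : 0 < κ := by apply div_pos <;> linarith
  have hκ1 : κ ≤ 1 / 2 := by rw [hκ, div_le_iff₀ (by positivity)]; linarith
  have hκ2 : lam * (1 + κ) ≤ lam₀ * (1 - κ) := by
    have : κ * (2 * lam₀) = lam₀ - lam := by rw [hκ]; field_simp
    nlinarith
  set c1 := κ * (η₀ / 2) ^ θ with hc1
  have hc10 : 0 < c1 := by positivity
  have hfin : ∀ ρ, volume (Qreg Ω lam θ xb ∩ ball xb ρ) ≠ ∞ := fun ρ =>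
    ((measure_mono inter_subset_right).trans_lt measure_ball_lt_top).ne
  -- the corkscrew ball
  have key1 : ∀ ρ, 0 < ρ → ρ ≤ δΓ →
      ω * c1 ^ n * (ρ ^ θ) ^ n ≤ volume.real (Qreg Ω lam θ xb ∩ ball xb ρ) := by
    intro ρ hρ hρδ
    obtain ⟨x, hxQ, -, hx2, hx3⟩ := H1 (ρ / 2) (by positivity) (by linarith)
    have hd := dB_pos hΩ hfr hxQ.1
    have hdx := dB_le_dist hxb x
    have hsub : ball x (κ * dB Ω x) ⊆ Qreg Ω lam θ xb ∩ ball xb ρ := by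
      intro y hy
      have hyx : dist y x < κ * dB Ω x := hy
      have hκd : κ * dB Ω x ≤ dB Ω x / 2 := by nlinarith
      have t1 := dist_triangle xb x y
      rw [dist_comm x y] at t1
      have t2 := dB_le_add Ω x y
      rw [dist_comm x y] at t2
      refine ⟨⟨ball_dB_subset hΩ hfr hxQ.1 (mem_ball.2 (by linarith)), ?_⟩, ?_⟩
      · have e1 : lam * dist xb y ≤ (1 - κ) * (lam₀ * dist xb x) := by
          have : dist xb y ≤ (1 + κ) * dist xb x := by nlinarith
          have h0 := dist_nonneg (x := xb) (y := x)
          nlinarith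
        have e2 : (1 - κ) ^ θ ≤ 1 - κ := by
          have := Real.rpow_le_rpow_of_exponent_ge (by linarith : 0 < 1 - κ) (by linarith) hθ
          rwa [Real.rpow_one] at this
        calc (lam * dist xb y) ^ θ ≤ ((1 - κ) * (lam₀ * dist xb x)) ^ θ :=
              Real.rpow_le_rpow (by positivity) e1 hθ0
          _ = (1 - κ) ^ θ * (lam₀ * dist xb x) ^ θ :=
              Real.mul_rpow (by linarith) (by positivity)
          _ ≤ (1 - κ) * dB Ω x := by
              apply mul_le_mul e2 hxQ.2.le (by positivity) (by linarith)
          _ < dB Ω y := by linarith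
      · rw [mem_ball, dist_comm]; linarith
    have hv := measureReal_mono hsub (hfin ρ)
    rw [vol_ball _ (by positivity), ← hωdef] at hv
    refine le_trans ?_ hv
    have e : c1 * ρ ^ θ ≤ κ * dB Ω x := by
      have : (η₀ / 2) ^ θ * ρ ^ θ = (η₀ * (ρ / 2)) ^ θ := by
        rw [← Real.mul_rpow (by positivity) hρ.le]; congr 1; ring
      rw [hc1, mul_assoc, this]
      gcongr
    calc ω * c1 ^ n * (ρ ^ θ) ^ n = (c1 * ρ ^ θ) ^ n * ω := by rw [mul_pow c1 (ρ ^ θ)]; ring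
      _ ≤ (κ * dB Ω x) ^ n * ω := by gcongr
  set c2 : ℝ := 2 * (2 * lam) ^ θ with hc2
  have hc20 : 0 < c2 := by positivity
  set c : ℝ := min (ω * c1 ^ n) (min (ω * c1 ^ n / c2 ^ n) (ω * (1 / 4) ^ n)) with hc
  refine ⟨c, by positivity, fun ρ hρ hρδ => ⟨?_, ?_⟩⟩
  · refine le_trans ?_ (key1 ρ hρ hρδ)
    gcongr; exact min_le_left _ _
  intro x hx
  have hd := dB_pos hΩ hfr hx.1.1
  have hdx := dB_le_dist hxb x
  have hxρ : dist x xb < ρ := hx.2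
  rw [dist_comm] at hxρ
  have hcb : c ≤ ω * c1 ^ n / c2 ^ n := (min_le_right _ _).trans (min_le_left _ _)
  have hcc : c ≤ ω * (1 / 4) ^ n := (min_le_right _ _).trans (min_le_right _ _)
  rcases le_or_gt (dB Ω x) (c2 * ρ ^ θ) with hcase | hcase
  · refine le_trans ?_ (key1 ρ hρ hρδ)
    calc c * dB Ω x ^ n ≤ (ω * c1 ^ n / c2 ^ n) * (c2 * ρ ^ θ) ^ n := by gcongr
      _ = ω * c1 ^ n * (ρ ^ θ) ^ n := by rw [mul_pow c2 (ρ ^ θ)]; field_simp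
  · have hr0 : 0 < dist xb x := by linarith
    set z : Euc n := x + (dB Ω x / 4 / dist xb x) • (xb - x) with hz
    have hzx : dist z x = dB Ω x / 4 := by
      rw [hz, dist_eq_norm, add_sub_cancel_left, norm_smul, ← dist_eq_norm, Real.norm_eq_abs,
        abs_of_pos (by positivity)]
      field_simp
    have hzxb : dist xb z = dist xb x - dB Ω x / 4 := by
      have : xb - z = (1 - dB Ω x / 4 / dist xb x) • (xb - x) := by
        rw [hz, sub_smul, one_smul]; abel
      have h1 : dB Ω x / 4 / dist xb x ≤ 1 := by rw [div_le_one hr0]; linarith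
      rw [dist_eq_norm, this, norm_smul, Real.norm_eq_abs, abs_of_nonneg (by linarith),
        ← dist_eq_norm]
      field_simp
    have hsub : ball z (dB Ω x / 4) ⊆ Qreg Ω lam θ xb ∩ ball xb ρ := by
      intro y hy
      have hyz : dist y z < dB Ω x / 4 := hy
      have t1 := dist_triangle y z x
      have t2 := dist_triangle xb z y
      rw [dist_comm z y] at t2
      have t3 := dB_le_add Ω x y
      rw [dist_comm x y] at t3
      have hyρ : dist xb y < ρ := by linarith
      refine ⟨⟨ball_dB_subset hΩ hfr hx.1.1 (mem_ball.2 (by linarith)), ?_⟩, ?_⟩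
      · have e1 : (lam * dist xb y) ^ θ ≤ (2 * lam * ρ) ^ θ := by
          apply Real.rpow_le_rpow (by positivity) _ hθ0
          nlinarith
        rw [Real.mul_rpow (by positivity) hρ.le] at e1
        rw [hc2] at hcase
        linarith
      · rw [mem_ball, dist_comm]; exact hyρ
    have hv := measureReal_mono hsub (hfin ρ)
    rw [vol_ball _ (by positivity), ← hωdef] at hv
    refine le_trans ?_ hv
    calc c * dB Ω x ^ n ≤ ω * (1 / 4) ^ n * dB Ω x ^ n := by gcongr
      _ = (dB Ω x / 4) ^ n * ω := by rw [div_pow, div_pow]; ring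

lemma isOpen_Qreg {Ω : Set (Euc n)} (hΩ : IsOpen Ω) (xb : Euc n) {θ lam : ℝ} (hθ : 0 ≤ θ) :
    IsOpen (Qreg Ω lam θ xb) := by
  have h1 : Continuous (fun x : Euc n => (lam * dist xb x) ^ θ) :=
    (Real.continuous_rpow_const hθ).comp (by fun_prop)
  have h2 : Continuous (fun x : Euc n => dB Ω x) := continuous_infDist_pt _
  exact hΩ.inter (isOpen_lt h1 h2)

/-- The average over the approach regions. -/
lemma avg_tendsto {n : ℕ} {Ω : Set (Euc n)} (hΩ : IsOpen Ω) {xb : Euc n} (hxb : xb ∈ frontier Ω)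
    {s : Euc n → ℝ} {p sl δ0 τ M θ lam lam₀ η₀ δΓ σ L : ℝ} (hp : 1 ≤ p) (hδ00 : 0 < δ0)
    (hδ0 : δ0 ≤ 1) (hsl0 : 0 ≤ sl) (hδΓ : 0 < δΓ)
    (hsl : ∀ x ∈ Ω ∩ ball xb δ0, sl ≤ s x) {u : Euc n → ℝ} (hu : MemN Ω s p u)
    (hM : ∀ R, 0 < R → R < δ0 → nuM Ω s p u (ball xb R) ≤ M * R ^ τ)
    (hθ : 1 ≤ θ) (hη₀ : 0 < η₀) (hlam : 0 < lam) (hlam₀ : lam < lam₀)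
    (H1 : IsCorkscrew Ω (Qreg Ω lam₀ θ xb) xb η₀ θ δΓ)
    (hσ : 0 < σ) (h1 : 0 < θ * (p * sl - n) + τ) (h2 : 0 < (p * sl - n) + τ)
    {C r1 : ℝ} (hC : 0 ≤ C) (hr1 : 0 < r1)
    (hg : ∀ x ∈ Qreg Ω lam θ xb, dist xb x < r1 → |gFun Ω u x - L| ≤ C * dist xb x ^ σ) :
    Tendsto (fun ρ : ℝ => ⨍ x in Qreg Ω lam θ xb ∩ ball xb ρ, |u x - L| ^ p)
      (𝓝[>] (0:ℝ)) (𝓝 0) := by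
  have hp0 : 0 < p := by linarith
  have hθ0 : 0 ≤ θ := by linarith
  have hfr : (frontier Ω).Nonempty := ⟨xb, hxb⟩
  obtain ⟨c, hc, hvol⟩ := vol_Qreg hΩ hxb hθ hη₀ hlam hlam₀ H1
  set a := p * sl - n with ha
  set A : ℝ := 2 ^ (p - 1) * (4 ^ n) ^ p / c with hA
  have hA0 : 0 ≤ A := by positivity
  set F : ℝ → ℝ := fun ρ =>
    A * M * (ρ ^ (θ * a + τ) + ρ ^ (a + τ)) + 2 ^ (p - 1) * (C * ρ ^ σ) ^ p with hF
  have hF0 : Tendsto F (𝓝[>] (0:ℝ)) (𝓝 0) := by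
    have hc1 : ContinuousAt F 0 := by
      have k1 := Real.continuousAt_rpow_const 0 _ (Or.inr h1.le)
      have k2 := Real.continuousAt_rpow_const 0 _ (Or.inr h2.le)
      have k3 := Real.continuousAt_rpow_const 0 _ (Or.inr hσ.le)
      have k4 : ContinuousAt (fun ρ : ℝ => (C * ρ ^ σ) ^ p) 0 :=
        (continuousAt_const.mul k3).rpow_const (Or.inr hp0.le)
      exact (continuousAt_const.mul (k1.add k2)).add (continuousAt_const.mul k4)
    have hv : F 0 = 0 := by
      simp only [hF]
      rw [Real.zero_rpow h1.ne', Real.zero_rpow h2.ne', Real.zero_rpow hσ.ne']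
      simp [Real.zero_rpow hp0.ne']
    have := hc1.tendsto
    rw [hv] at this
    exact this.mono_left nhdsWithin_le_nhds
  refine tendsto_of_tendsto_of_tendsto_of_le_of_le' tendsto_const_nhds hF0 ?_ ?_
  · refine Eventually.of_forall fun ρ => ?_
    rw [setAverage_eq]
    have : 0 ≤ ∫ x in Qreg Ω lam θ xb ∩ ball xb ρ, |u x - L| ^ p :=
      integral_nonneg fun x => Real.rpow_nonneg (abs_nonneg _) _
    simp only [smul_eq_mul]; positivity
  have hpos : 0 < min (min r1 δ0) δΓ := by positivity
  filter_upwards [Ioo_mem_nhdsGT hpos] with ρ hρI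
  obtain ⟨hρ, hρlt⟩ := hρI
  have hρr : ρ < r1 := hρlt.trans_le ((min_le_left _ _).trans (min_le_left _ _))
  have hρδ : ρ < δ0 := hρlt.trans_le ((min_le_left _ _).trans (min_le_right _ _))
  have hρΓ : ρ < δΓ := hρlt.trans_le (min_le_right _ _)
  have hρ1 : ρ ≤ 1 := by linarith
  obtain ⟨hv1, hv2⟩ := hvol ρ hρ hρΓ.le
  set Q := Qreg Ω lam θ xb ∩ ball xb ρ with hQ
  set V := volume.real Q with hV
  have hρθ : 0 < ρ ^ θ := Real.rpow_pos_of_pos hρ _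
  have hV0 : 0 < V := lt_of_lt_of_le (by positivity) hv1
  set S := ρ ^ (θ * a) + ρ ^ a with hS
  have hS0 : 0 ≤ S := by positivity
  have hQΩ : Q ⊆ Ω := fun x hx => hx.1.1
  have hQm : MeasurableSet Q := ((isOpen_Qreg hΩ xb hθ0).inter isOpen_ball).measurableSet
  have hQfin : volume Q ≠ ∞ := ((measure_mono inter_subset_right).trans_lt measure_ball_lt_top).ne
  have hpt : ∀ x ∈ Q, |u x - L| ^ p ≤
      A * V * S * nuInt Ω s p u x + 2 ^ (p - 1) * (C * ρ ^ σ) ^ p := by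
    intro x hx
    have hxρ : dist x xb < ρ := hx.2
    rw [dist_comm] at hxρ
    have hd := dB_pos hΩ hfr (hQΩ hx)
    have hdx := dB_le_dist hxb x
    have b1 := abs_sub_gFun_self_le hΩ hfr hu.1 (hQΩ hx)
    have b2 := hg x hx.1 (by linarith)
    have b3 : dist xb x ^ σ ≤ ρ ^ σ := Real.rpow_le_rpow dist_nonneg hxρ.le hσ.le
    have b4 : |u x - L| ≤ 4 ^ n * osc Ω u x + C * ρ ^ σ := by
      have := abs_sub_le (u x) (gFun Ω u x) L
      have : C * dist xb x ^ σ ≤ C * ρ ^ σ := by gcongr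
      linarith
    have ho := osc_nonneg Ω u x
    have b5 : |u x - L| ^ p ≤ 2 ^ (p - 1) * ((4 ^ n * osc Ω u x) ^ p + (C * ρ ^ σ) ^ p) := by
      refine (Real.rpow_le_rpow (abs_nonneg _) b4 hp0.le).trans ?_
      exact real_rpow_add_le (by positivity) (by positivity) hp
    have b6 := osc_rpow_le hΩ hxb hp hδ0 hsl u (y := x)
      ⟨hQΩ hx, ball_subset_ball hρδ.le hx.2⟩
    -- bound of d^{p sl}
    have b7 : dB Ω x ^ (p * sl) ≤ V / c * S := by
      set m := max (dB Ω x) (ρ ^ θ) with hm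
      have hm0 : 0 < m := lt_max_of_lt_left hd
      have hmρ : m ≤ ρ := by
        apply max_le (by linarith)
        have := Real.rpow_le_rpow_of_exponent_ge hρ hρ1 hθ
        rwa [Real.rpow_one] at this
      have e1 : dB Ω x ^ (p * sl) ≤ m ^ (p * sl) :=
        Real.rpow_le_rpow hd.le (le_max_left _ _) (by positivity)
      have e2 : m ^ (p * sl) = m ^ n * m ^ a := by
        rw [← Real.rpow_natCast, ← Real.rpow_add hm0, ha]; congr 1; ring
      have e3 : c * m ^ n ≤ V := by
        rcases max_cases (dB Ω x) (ρ ^ θ) with ⟨h, -⟩ | ⟨h, -⟩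
        · rw [hm, h]; exact hv2 x hx
        · rw [hm, h]; exact hv1
      have e4 : m ^ n ≤ V / c := by rw [le_div_iff₀ hc]; linarith
      have e5 := rpow_le_add_of_mem (q := a) hρθ (le_max_right (dB Ω x) (ρ ^ θ)) hmρ
      rw [← Real.rpow_mul hρ.le] at e5
      refine e1.trans (e2.le.trans ?_)
      exact mul_le_mul e4 e5 (by positivity) (by positivity)
    have hnn := nuInt_nonneg Ω s p u x
    rw [Real.mul_rpow (by positivity) ho] at b5
    calc |u x - L| ^ p ≤ 2 ^ (p - 1) * ((4 ^ n) ^ p * osc Ω u x ^ p + (C * ρ ^ σ) ^ p) := b5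
      _ ≤ 2 ^ (p - 1) * ((4 ^ n) ^ p * (nuInt Ω s p u x * (V / c * S)) + (C * ρ ^ σ) ^ p) := by
          gcongr
          exact b6.trans (by gcongr)
      _ = _ := by rw [hA]; ring
  have hnuQ : IntegrableOn (nuInt Ω s p u) Q := hu.2.mono_set hQΩ
  have hmaj : IntegrableOn (fun x => A * V * S * nuInt Ω s p u x + 2 ^ (p - 1) * (C * ρ ^ σ) ^ p) Q :=
    (hnuQ.const_mul _).add (integrableOn_const hQfin)
  have hI : ∫ x in Q, |u x - L| ^ p ≤
      A * V * S * (∫ x in Q, nuInt Ω s p u x) + V * (2 ^ (p - 1) * (C * ρ ^ σ) ^ p) := by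
    have e1 : ∫ x in Q, |u x - L| ^ p ≤
        ∫ x in Q, (A * V * S * nuInt Ω s p u x + 2 ^ (p - 1) * (C * ρ ^ σ) ^ p) := by
      refine integral_mono_of_nonneg (ae_of_all _ fun x => Real.rpow_nonneg (abs_nonneg _) _)
        hmaj ?_
      exact (ae_restrict_iff' hQm).2 (ae_of_all _ hpt)
    refine e1.trans (le_of_eq ?_)
    rw [integral_add (hnuQ.const_mul _) (integrableOn_const hQfin), integral_const_mul,
      setIntegral_const]
    rfl
  have hJ : ∫ x in Q, nuInt Ω s p u x ≤ M * ρ ^ τ := by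
    refine le_trans ?_ (hM ρ hρ hρδ)
    refine setIntegral_mono_set (hu.2.mono_set inter_subset_left)
      (ae_of_all _ fun z => nuInt_nonneg _ _ _ _ _) ?_
    exact (show Q ⊆ Ω ∩ ball xb ρ from subset_inter hQΩ inter_subset_right).eventuallyLE
  rw [setAverage_eq, smul_eq_mul, inv_mul_le_iff₀ hV0]
  refine hI.trans ?_
  have e1 : A * V * S * (∫ x in Q, nuInt Ω s p u x) ≤ A * V * S * (M * ρ ^ τ) := by gcongr
  have e2 : V * F ρ = A * V * S * (M * ρ ^ τ) + V * (2 ^ (p - 1) * (C * ρ ^ σ) ^ p) := by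
    simp only [hF, hS]
    rw [Real.rpow_add hρ, Real.rpow_add hρ]; ring
  linarith

lemma alphaFun_eq_min (n : ℕ) (p θ : ℝ) (hθ : 1 ≤ θ) (x : ℝ) :
    alphaFun n p x θ = min (p * (1 - θ) + (p * x - n) * θ) ((1 - θ) + (p * x - n)) := by
  unfold alphaFun
  split_ifs with h
  · rw [min_eq_left]; nlinarith
  · rw [min_eq_right]; push Not at h; nlinarith

lemma sLow_antitoneOn {Ω : Set (Euc n)} {xb : Euc n} (hxb : xb ∈ frontier Ω) {s : Euc n → ℝ}
    (hs0 : ∀ x, 0 ≤ s x) : AntitoneOn (sLow Ω s xb) (Ioi 0) := by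
  intro a ha b hb hab
  unfold sLow
  apply csInf_le_csInf
  · exact ⟨0, by rintro _ ⟨x, -, rfl⟩; exact hs0 x⟩
  · have : xb ∈ closure Ω := frontier_subset_closure hxb
    obtain ⟨y, hy, hd⟩ := Metric.mem_closure_iff.1 this a ha
    exact ⟨s y, y, ⟨hy, by rw [mem_ball, dist_comm]; exact hd⟩, rfl⟩
  · exact image_mono (inter_subset_inter_right _ (ball_subset_ball hab))

lemma alphaLow_tendsto {Ω : Set (Euc n)} {xb : Euc n} (hxb : xb ∈ frontier Ω) {s : Euc n → ℝ}
    (hs0 : ∀ x, 0 ≤ s x) (hsb : ∃ b : ℝ, ∀ x, s x ≤ b) (p : ℝ) {θΓ : Euc n → ℝ}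
    (hθ : 1 ≤ θΓ xb) :
    Tendsto (fun δ => alphaLow Ω s p θΓ xb δ) (𝓝[>] (0:ℝ)) (𝓝 (alphaLow0 Ω s p θΓ xb)) := by
  obtain ⟨b, hb⟩ := hsb
  have hbdd : BddAbove (sLow Ω s xb '' Ioi 0) := by
    refine ⟨b, ?_⟩
    rintro _ ⟨δ, hδ, rfl⟩
    have : xb ∈ closure Ω := frontier_subset_closure hxb
    obtain ⟨y, hy, hd⟩ := Metric.mem_closure_iff.1 this δ hδ
    have hmem : s y ∈ s '' (Ω ∩ ball xb δ) :=
      ⟨y, ⟨hy, by rw [mem_ball, dist_comm]; exact hd⟩, rfl⟩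
    have hbel : BddBelow (s '' (Ω ∩ ball xb δ)) := ⟨0, by rintro _ ⟨x, -, rfl⟩; exact hs0 x⟩
    exact (csInf_le hbel hmem).trans (hb y)
  have h1 := (sLow_antitoneOn hxb hs0).tendsto_nhdsGT hbdd
  refine tendsto_nhds_limUnder ⟨alphaFun n p (sSup (sLow Ω s xb '' Ioi 0)) (θΓ xb), ?_⟩
  unfold alphaLow
  have hcont : Continuous (fun x => alphaFun n p x (θΓ xb)) := by
    simp only [alphaFun_eq_min n p _ hθ]
    fun_prop
  exact (hcont.tendsto _).comp h1

/-- Lebesgue point property along approach regions. Under (H1) and (H2), at a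
point `xb₀ ∈ A_{ω₀,0} ∩ Γ_{τ₀}` (`ω₀ < τ₀`), the boundary limit `L` of `g(·;u)` along
`Q_{λ₀}(xb₀)` exists and the means of `|u − L|ᵖ` over `Q_{λ,ρ}(xb₀)` vanish as `ρ → 0⁺`. -/
theorem statement9 (n : ℕ) (hn : 1 ≤ n) (p t CΓ δΓ : ℝ)
    (hp : 1 ≤ p) (ht : 0 ≤ t) (htn : t < n) (hCΓ : 1 ≤ CΓ) (hδΓ0 : 0 < δΓ) (hδΓ1 : δΓ < 1)
    (Ω : Set (Euc n)) (hΩo : IsOpen Ω) (hΩne : Ω.Nonempty) (hfr : (frontier Ω).Nonempty)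
    (Γ : Set (Euc n)) (hΓfr : Γ ⊆ frontier Ω)
    (θΓ : Euc n → ℝ) (hθ1 : ∀ xb, 1 ≤ θΓ xb) (hθb : ∃ b : ℝ, ∀ xb, θΓ xb ≤ b)
    (s : Euc n → ℝ) (hsm : Measurable s) (hs0 : ∀ x, 0 ≤ s x) (hsb : ∃ b : ℝ, ∀ x, s x ≤ b)
    (lam₀ η₀ : ℝ) (hlam₀ : 0 < lam₀) (hlam₀1 : lam₀ < 1) (hη₀ : 0 < η₀) (hη₀1 : η₀ < 1)
    (H1 : ∀ xb ∈ Γ, IsCorkscrew Ω (Qreg Ω lam₀ (θΓ xb) xb) xb η₀ (θΓ xb) δΓ)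
    (ε : ℝ → ℝ) (hεmono : ∀ a b : ℝ, 0 < a → a ≤ b → b < 1 → ε a ≤ ε b)
    (H2 : ∀ xb ∈ Γ, ConnectedTo Ω (Ω ∩ ball xb δΓ) xb CΓ (θΓ xb) (δΓ / (3 * CΓ)) ε)
    (u : Euc n → ℝ) (hu : MemN Ω s p u)
    (τ₀ ω₀ : ℝ) (hτ₀ : 0 ≤ τ₀) (hω₀ : ω₀ < τ₀)
    (xb₀ : Euc n) (hxb₀Γ : xb₀ ∈ Γ) (hxb₀A : 0 ≤ alphaLow0 Ω s p θΓ xb₀ + ω₀)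
    (hxb₀τ : xb₀ ∈ GammaTau Ω s p u Γ τ₀) :
    ∃ L : ℝ,
      Tendsto (gFun Ω u) (𝓝[Qreg Ω lam₀ (θΓ xb₀) xb₀] xb₀) (𝓝 L) ∧
      ∀ lam : ℝ, 0 < lam → lam < lam₀ →
        Tendsto (fun ρ : ℝ =>
            ⨍ x in Qreg Ω lam (θΓ xb₀) xb₀ ∩ ball xb₀ ρ, |u x - L| ^ p)
          (𝓝[>] (0:ℝ)) (𝓝 0) := by
  have hxb : xb₀ ∈ frontier Ω := hΓfr hxb₀Γ
  set θ := θΓ xb₀ with hθdef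
  have hθ : 1 ≤ θ := hθ1 xb₀
  have hp0 : 0 < p := by linarith
  obtain ⟨-, M, hMev⟩ := hxb₀τ
  have hα := alphaLow_tendsto hxb hs0 hsb p (θΓ := θΓ) hθ
  have hαev : ∀ᶠ δ in 𝓝[>] (0:ℝ), -τ₀ < alphaLow Ω s p θΓ xb₀ δ :=
    hα.eventually (lt_mem_nhds (by linarith))
  obtain ⟨e1, he1, hIoo⟩ := mem_nhdsGT_iff_exists_Ioo_subset.1 (hMev.and hαev)
  have he1' : 0 < e1 := he1
  obtain ⟨δ0, hδ00, hδ01, hδ0e⟩ : ∃ δ0 : ℝ, 0 < δ0 ∧ δ0 ≤ 1 ∧ δ0 < e1 :=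
    ⟨min (e1 / 2) 1, by positivity, min_le_right _ _,
      (min_le_left _ _).trans_lt (by linarith)⟩
  have hM : ∀ R, 0 < R → R < δ0 → nuM Ω s p u (ball xb₀ R) ≤ max M 0 * R ^ τ₀ := by
    intro R hR hRδ
    have h1 : R ^ (-τ₀) * nuM Ω s p u (ball xb₀ R) ≤ M := (hIoo ⟨hR, hRδ.trans hδ0e⟩).1
    have hpos := Real.rpow_pos_of_pos hR τ₀
    rw [Real.rpow_neg hR.le, inv_mul_le_iff₀ hpos] at h1
    have h2 : R ^ τ₀ * M ≤ R ^ τ₀ * max M 0 := by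
      gcongr; exact le_max_left _ _
    linarith
  have hαδ : -τ₀ < alphaFun n p (sLow Ω s xb₀ δ0) θ := (hIoo ⟨hδ00, hδ0e⟩).2
  set sl := sLow Ω s xb₀ δ0 with hsl
  have hsl0 : 0 ≤ sl := Real.sInf_nonneg (by rintro _ ⟨x, -, rfl⟩; exact hs0 x)
  have hslle : ∀ x ∈ Ω ∩ ball xb₀ δ0, sl ≤ s x := fun x hx =>
    csInf_le ⟨0, by rintro _ ⟨x, -, rfl⟩; exact hs0 x⟩ (mem_image_of_mem s hx)
  rw [alphaFun_eq_min n p θ hθ, lt_min_iff] at hαδ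
  obtain ⟨hα1, hα2⟩ := hαδ
  set a := p * sl - n with ha
  have h2 : 0 < a + τ₀ := by linarith
  have h1 : 0 < θ * a + τ₀ := by nlinarith
  obtain ⟨σ, hσ, hσ1, hσ2⟩ : ∃ σ : ℝ, 0 < σ ∧ σ ≤ 1 + θ * (a / p - 1) + τ₀ / p ∧
      σ ≤ 1 + (a / p - 1) + τ₀ / p := by
    refine ⟨min (1 + θ * (a / p - 1) + τ₀ / p) (1 + (a / p - 1) + τ₀ / p), ?_,
      min_le_left _ _, min_le_right _ _⟩
    apply lt_min
    · have : 1 + θ * (a / p - 1) + τ₀ / p = (p * (1 - θ) + a * θ + τ₀) / p := by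
        field_simp; ring
      rw [this]; apply div_pos _ hp0; linarith
    · have : 1 + (a / p - 1) + τ₀ / p = (a + τ₀) / p := by field_simp; ring
      rw [this]; positivity
  obtain ⟨L, hL⟩ := gFun_limit hΩo hxb (g := gFun Ω u) hθ hσ hη₀ hη₀1 (H1 xb₀ hxb₀Γ)
    (fun lam hl hl1 => gFun_conn hΩo hxb hp hδ00 hδ01 hsl0 (le_max_right M 0) hδΓ0 hslle hu hM hCΓ
      (H2 xb₀ hxb₀Γ) hσ1 hσ2 hl hl1)
  refine ⟨L, ?_, ?_⟩
  · obtain ⟨C, hC, r1, hr1, hg⟩ := hL lam₀ hlam₀ hlam₀1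
    have hz : Tendsto (fun x : Euc n => C * dist xb₀ x ^ σ)
        (𝓝[Qreg Ω lam₀ θ xb₀] xb₀) (𝓝 0) := by
      have hc : Continuous (fun x : Euc n => C * dist xb₀ x ^ σ) :=
        continuous_const.mul ((Real.continuous_rpow_const hσ.le).comp (by fun_prop))
      have := hc.tendsto xb₀
      simp only [dist_self, Real.zero_rpow hσ.ne', mul_zero] at this
      exact this.mono_left nhdsWithin_le_nhds
    rw [tendsto_iff_dist_tendsto_zero]
    refine squeeze_zero' (Eventually.of_forall fun x => dist_nonneg) ?_ hz
    have hb : ∀ᶠ x in 𝓝[Qreg Ω lam₀ θ xb₀] xb₀, x ∈ ball xb₀ r1 :=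
      nhdsWithin_le_nhds (ball_mem_nhds _ hr1)
    filter_upwards [self_mem_nhdsWithin, hb] with x hx hxb'
    rw [Real.dist_eq]
    exact hg x hx (by rw [dist_comm]; exact hxb')
  · intro lam hlam hlam'
    obtain ⟨C, hC, r1, hr1, hg⟩ := hL lam hlam (hlam'.trans hlam₀1)
    exact avg_tendsto hΩo hxb hp hδ00 hδ01 hsl0 hδΓ0 hslle hu hM hθ hη₀ hlam hlam'
      (H1 xb₀ hxb₀Γ) hσ h1 h2 hC hr1 hg
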